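/- arXiv:2307.03451 — 6 statements merged into one kernel-verified Lean document; each statement's English description precedes it below -/
import Mathlib

section
/- Let n, h ∈ ℕ with n ≥ 1, F ∈ ℝ^{n×n} and H ∈ ℝ^{h×n}. If the pair (F,H) is observable, i.e., the observability matrix col(H, HF, HF², …, HF^{n−1}) ∈ ℝ^{nh×n} has rank n, then there exists a matrix R ∈ ℝ^{n×h} such that (F − RH)^n = 0 (F − RH is nilpotent). -/
/-- In a complemented modular lattice, a chain `U 0 = ⊥ ≤ U 1 ≤ ⋯ ≤ U n` admits an element `c`
disjoint from a given `a` such that `a` and `c` split every member of the chain. -/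
theorem exists_disjoint_splitting_chain {α : Type*} [Lattice α] [BoundedOrder α]
    [IsModularLattice α] [ComplementedLattice α] {U : ℕ → α} (hU : Monotone U) (hU0 : U 0 = ⊥)
    (a : α) (n : ℕ) :
    ∃ c ≤ U n, Disjoint c a ∧ ∀ k ≤ n, U k ≤ (U k ⊓ a) ⊔ (U k ⊓ c) := by
  induction n with
  | zero =>
    refine ⟨⊥, bot_le, disjoint_bot_left, fun k hk => ?_⟩
    obtain rfl : k = 0 := by omega
    simp [hU0]
  | succ n ih =>
    obtain ⟨c, hc, hdisj, hsplit⟩ := ih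
    obtain ⟨d, hcd, hd⟩ :=
      Disjoint.exists_isCompl (a := c) (b := U (n + 1) ⊓ a) (hdisj.mono_right inf_le_right)
    refine ⟨d ⊓ U (n + 1), inf_le_right, ?_, fun k hk => ?_⟩
    · rw [disjoint_iff_inf_le, inf_assoc]
      exact hd.disjoint.le_bot
    · rcases Nat.le_succ_iff.mp hk with hk | rfl
      · exact (hsplit k hk).trans <| sup_le_sup_left
          (inf_le_inf_left _ (le_inf hcd (hc.trans (hU n.le_succ)))) _
      · have hmod := sup_inf_assoc_of_le d (inf_le_left : U (n + 1) ⊓ a ≤ U (n + 1))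
        rw [sup_comm, hd.sup_eq_top, top_inf_eq] at hmod
        exact hmod.le.trans (sup_le_sup_left (le_inf inf_le_right le_rfl) _)

/-- The states reachable after `k` steps of `f` along trajectories whose outputs under `g` vanish. -/
def zeroOutputReachable {K V W : Type*} [Field K] [AddCommGroup V] [Module K V]
    [AddCommGroup W] [Module K W] (f : V →ₗ[K] V) (g : V →ₗ[K] W) : ℕ → Submodule K V
  | 0 => ⊤
  | k + 1 => (zeroOutputReachable f g k ⊓ LinearMap.ker g).map f

section

variable {K V W : Type*} [Field K] [AddCommGroup V] [Module K V] [AddCommGroup W] [Module K W]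

theorem zeroOutputReachable_antitone (f : V →ₗ[K] V) (g : V →ₗ[K] W) :
    Antitone (zeroOutputReachable f g) := by
  refine antitone_nat_of_succ_le fun k => ?_
  induction k with
  | zero => exact le_top
  | succ k ih => exact Submodule.map_mono (inf_le_inf_right _ ih)

theorem exists_of_mem_zeroOutputReachable (f : V →ₗ[K] V) (g : V →ₗ[K] W) {k : ℕ} {y : V}
    (hy : y ∈ zeroOutputReachable f g k) :
    ∃ x, (f ^ k) x = y ∧ ∀ i < k, g ((f ^ i) x) = 0 := by
  induction k generalizing y with
  | zero => exact ⟨y, by simp⟩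
  | succ k ih =>
    obtain ⟨z, ⟨hz, hgz⟩, rfl⟩ := hy
    obtain ⟨x, rfl, hx⟩ := ih hz
    refine ⟨x, by rw [pow_succ', Module.End.mul_apply], fun i hi => ?_⟩
    rcases Nat.lt_succ_iff_lt_or_eq.mp hi with hi | rfl
    · exact hx i hi
    · exact hgz

/-- An observable pair of linear maps admits a deadbeat output injection. -/
theorem exists_sub_comp_pow_eq_zero (f : V →ₗ[K] V) (g : V →ₗ[K] W) (n : ℕ)
    (hobs : ∀ x, (∀ i < n, g ((f ^ i) x) = 0) → x = 0) :
    ∃ r : W →ₗ[K] V, (f - r ∘ₗ g) ^ n = 0 := by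
  have hbot : zeroOutputReachable f g n = ⊥ := by
    refine (Submodule.eq_bot_iff _).mpr fun y hy => ?_
    obtain ⟨x, rfl, hx⟩ := exists_of_mem_zeroOutputReachable f g hy
    rw [hobs x hx, map_zero]
  obtain ⟨c, -, hdisj, hsplit⟩ := exists_disjoint_splitting_chain
    (U := fun k => zeroOutputReachable f g (n - k))
    (fun i j hij => zeroOutputReachable_antitone f g (Nat.sub_le_sub_left hij n))
    (by simpa using hbot) (LinearMap.ker g) n
  obtain ⟨s, hs⟩ := LinearMap.exists_leftInverse_of_injective (g.domRestrict c)
    (LinearMap.ker_eq_bot.mpr (LinearMap.injective_domRestrict_iff.mpr hdisj))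
  refine ⟨f ∘ₗ c.subtype ∘ₗ s, ?_⟩
  have hstep : ∀ k ≤ n, ∀ x ∈ zeroOutputReachable f g k,
      (f - (f ∘ₗ c.subtype ∘ₗ s) ∘ₗ g) x ∈ zeroOutputReachable f g (k + 1) := by
    intro k hk x hx
    have hsup := hsplit (n - k) (Nat.sub_le n k)
    simp only [Nat.sub_sub_self hk] at hsup
    obtain ⟨y, hy, z, hz, rfl⟩ := Submodule.mem_sup.mp (hsup hx)
    have hsz : s (g z) = ⟨z, hz.2⟩ := LinearMap.congr_fun hs ⟨z, hz.2⟩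
    have hgy : g y = 0 := hy.2
    refine ⟨y, hy, ?_⟩
    simp [hgy, hsz]
  have hiter : ∀ k ≤ n, ∀ x,
      ((f - (f ∘ₗ c.subtype ∘ₗ s) ∘ₗ g) ^ k) x ∈ zeroOutputReachable f g k := by
    intro k
    induction k with
    | zero => exact fun _ _ => Submodule.mem_top
    | succ k ih =>
      intro hk x
      rw [pow_succ', Module.End.mul_apply]
      exact hstep k (by omega) _ (ih (by omega) x)
  ext x
  simpa [hbot] using hiter n le_rfl x

end

/-- If the pair `(F, H)` is observable, i.e. the observability matrix
`col(H, HF, HF², …, HF^{n−1})` has rank `n`, then there exists `R` such that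
`(F − R*H)^n = 0`. -/
theorem stmt_0 (n h : ℕ) (hn : 1 ≤ n)
    (F : Matrix (Fin n) (Fin n) ℝ) (H : Matrix (Fin h) (Fin n) ℝ)
    (hobs : (Matrix.of fun (p : Fin n × Fin h) (j : Fin n) =>
      (H * F ^ (p.1 : ℕ)) p.2 j).rank = n) :
    ∃ R : Matrix (Fin n) (Fin h) ℝ, (F - R * H) ^ n = 0 := by
  have hker : ∀ x, (∀ i < n, Matrix.toLin' H ((Matrix.toLin' F ^ i) x) = 0) → x = 0 := by
    intro x hx
    set O := Matrix.of fun (p : Fin n × Fin h) (j : Fin n) => (H * F ^ (p.1 : ℕ)) p.2 j with hO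
    have hrank := LinearMap.finrank_range_add_finrank_ker O.mulVecLin
    rw [← Matrix.rank, hobs, Module.finrank_fin_fun, Nat.add_eq_left,
      Submodule.finrank_eq_zero] at hrank
    refine LinearMap.ker_eq_bot'.mp hrank x ?_
    ext p
    have hp := congrFun (hx p.1 p.1.2) p.2
    rw [← Matrix.toLin'_pow, Matrix.toLin'_apply, Matrix.toLin'_apply, Matrix.mulVec_mulVec] at hp
    exact hp
  obtain ⟨r, hr⟩ := exists_sub_comp_pow_eq_zero _ _ n hker
  refine ⟨LinearMap.toMatrix' r, Matrix.toLin'.injective ?_⟩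
  rw [Matrix.toLin'_pow, map_sub, Matrix.toLin'_mul, Matrix.toLin'_toMatrix', hr, map_zero]
end

section
/- Let n, l, h ∈ ℕ with n ≥ 1, F ∈ ℝ^{n×n}, G ∈ ℝ^{n×l}, H ∈ ℝ^{h×n}, and x₀ ∈ ℝ^n. Suppose the pair (F,G) is controllable and the pair (F,H) is observable. Set n̄ := n(h+l). Then there exist a matrix M ∈ ℝ^{n×n̄} and vectors y(−1), …, y(−n) ∈ ℝ^l and u(−1), …, u(−n) ∈ ℝ^h with the following property: for every input sequence y: ℕ → ℝ^l, the solution x: ℕ → ℝ^n of x(k+1) = F x(k) + G y(k) with x(0) = x₀ and output u(k) := H x(k) satisfies x(k) = M z(k) for all k ∈ ℕ, where z(k) := col( y(k−1), …, y(k−n), u(k−1), …, u(k−n) ) ∈ ℝ^{n̄} (using the chosen vectors for negative time indices). -/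
/-- The state reached after `j` steps of `x ↦ F x + G y`, as a linear function of the initial state
and a window of `n` inputs listed from the latest to the earliest. -/
noncomputable def windowState {n l : ℕ} (F : Matrix (Fin n) (Fin n) ℝ)
    (G : Matrix (Fin n) (Fin l) ℝ) :
    ℕ → ((Fin n → ℝ) × (Fin n × Fin l → ℝ)) →ₗ[ℝ] (Fin n → ℝ)
  | 0 => LinearMap.fst ℝ _ _
  | j + 1 => F.mulVecLin ∘ₗ windowState F G j +
      if hj : j < n then
        G.mulVecLin ∘ₗ LinearMap.funLeft ℝ ℝ (fun b => (Fin.rev ⟨j, hj⟩, b)) ∘ₗ LinearMap.snd ℝ _ _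
      else 0

/-- The data available to the observer over a window: the inputs and the outputs, each listed from
the latest to the earliest. -/
noncomputable def windowData {n l h : ℕ} (F : Matrix (Fin n) (Fin n) ℝ)
    (G : Matrix (Fin n) (Fin l) ℝ) (H : Matrix (Fin h) (Fin n) ℝ) :
    ((Fin n → ℝ) × (Fin n × Fin l → ℝ)) →ₗ[ℝ] ((Fin n × Fin l) ⊕ (Fin n × Fin h) → ℝ) where
  toFun e := Sum.elim e.2 fun p => H.mulVec (windowState F G (p.1.rev : ℕ) e) p.2
  map_add' e e' := by ext (p | p) <;> simp [Matrix.mulVec_add]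
  map_smul' c e := by ext (p | p) <;> simp [Matrix.mulVec_smul]

theorem windowState_zero {n l : ℕ} (F : Matrix (Fin n) (Fin n) ℝ) (G : Matrix (Fin n) (Fin l) ℝ)
    (e : (Fin n → ℝ) × (Fin n × Fin l → ℝ)) : windowState F G 0 e = e.1 := rfl

theorem windowState_succ {n l : ℕ} (F : Matrix (Fin n) (Fin n) ℝ) (G : Matrix (Fin n) (Fin l) ℝ)
    (e : (Fin n → ℝ) × (Fin n × Fin l → ℝ)) {j : ℕ} (hj : j < n) :
    windowState F G (j + 1) e =
      F.mulVec (windowState F G j e) + G.mulVec (fun b => e.2 (Fin.rev ⟨j, hj⟩, b)) := by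
  simp only [windowState, dif_pos hj]
  rfl

theorem windowState_input_zero {n l : ℕ} (F : Matrix (Fin n) (Fin n) ℝ)
    (G : Matrix (Fin n) (Fin l) ℝ) (x : Fin n → ℝ) {j : ℕ} (hj : j ≤ n) :
    windowState F G j (x, 0) = (F ^ j).mulVec x := by
  induction j with
  | zero => simp [windowState_zero]
  | succ j ih =>
    rw [windowState_succ F G _ hj, ih (by omega), Matrix.mulVec_mulVec, ← pow_succ']
    simp only [Pi.zero_apply]
    rw [← Pi.zero_def, Matrix.mulVec_zero, add_zero]

/-- Observability makes the initial state and the inputs recoverable from the window data. -/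
theorem windowData_injective {n l h : ℕ} (F : Matrix (Fin n) (Fin n) ℝ)
    (G : Matrix (Fin n) (Fin l) ℝ) (H : Matrix (Fin h) (Fin n) ℝ)
    (hobs : (Matrix.of fun (p : Fin n × Fin h) (j : Fin n) =>
      (H * F ^ (p.1 : ℕ)) p.2 j).rank = n) :
    LinearMap.ker (windowData F G H) = ⊥ := by
  rw [LinearMap.ker_eq_bot']
  rintro ⟨x, v⟩ hz
  have hv : v = 0 := by
    ext p
    exact congrFun hz (Sum.inl p)
  subst hv
  have hker := LinearMap.finrank_range_add_finrank_ker
    (Matrix.of fun (p : Fin n × Fin h) (j : Fin n) => (H * F ^ (p.1 : ℕ)) p.2 j).mulVecLin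
  rw [Matrix.rank] at hobs
  rw [hobs, Module.finrank_fin_fun, Nat.add_eq_left, Submodule.finrank_eq_zero,
    LinearMap.ker_eq_bot'] at hker
  rw [hker x ?_]
  · rfl
  ext p
  have := congrFun hz (Sum.inr (p.1.rev, p.2))
  simp only [windowData, LinearMap.coe_mk, AddHom.coe_mk, Sum.elim_inr, Fin.rev_rev] at this
  rw [windowState_input_zero F G x p.1.2.le, Matrix.mulVec_mulVec] at this
  exact this

theorem windowState_initial_zero {n l : ℕ} (F : Matrix (Fin n) (Fin n) ℝ)
    (G : Matrix (Fin n) (Fin l) ℝ) (v : Fin n × Fin l → ℝ) {j : ℕ} (hj : j ≤ n) :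
    windowState F G j (0, v) = ∑ i : Fin j, (F ^ (i : ℕ) * G).mulVec
      (fun b => v (⟨n - j + i, by omega⟩, b)) := by
  induction j with
  | zero => simp [windowState_zero]
  | succ j ih =>
    rw [windowState_succ F G _ hj, ih (by omega), Fin.sum_univ_succ, Matrix.mulVec_sum, add_comm]
    congr 1
    · simp [Fin.rev]
    · refine Finset.sum_congr rfl fun i _ => ?_
      rw [Matrix.mulVec_mulVec, ← Matrix.mul_assoc, ← pow_succ']
      simp only [Fin.val_succ, show n - (j + 1) + ((i : ℕ) + 1) = n - j + i by omega]

/-- Controllability lets every state be reached from the origin in `n` steps. -/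
theorem exists_windowState_eq {n l : ℕ} (F : Matrix (Fin n) (Fin n) ℝ)
    (G : Matrix (Fin n) (Fin l) ℝ) (x₀ : Fin n → ℝ)
    (hctrl : (Matrix.of fun (i : Fin n) (p : Fin n × Fin l) =>
      (F ^ (p.1 : ℕ) * G) i p.2).rank = n) :
    ∃ v, windowState F G n (0, v) = x₀ := by
  rw [Matrix.rank] at hctrl
  have htop := Submodule.eq_top_of_finrank_eq (hctrl.trans (Module.finrank_fin_fun ℝ).symm)
  obtain ⟨v, hv⟩ := LinearMap.range_eq_top.mp htop x₀
  refine ⟨v, ?_⟩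
  rw [← hv, windowState_initial_zero F G v le_rfl]
  ext i
  simp [Matrix.mulVec, dotProduct, Fintype.sum_prod_type, Finset.sum_apply]


/-- If `(F,G)` is controllable and `(F,H)` is observable, then there exist a
matrix `M ∈ ℝ^{n×n̄}` (with `n̄ = n(h+l)`, index type `(Fin n × Fin l) ⊕ (Fin n × Fin h)`)
and vectors `y(−1), …, y(−n)`, `u(−1), …, u(−n)` such that for every input sequence `y`,
the solution `x` of `x(k+1) = F x(k) + G y(k)`, `x(0) = x₀`, with output `u(k) = H x(k)`
satisfies `x(k) = M z(k)` where `z(k) = col(y(k−1),…,y(k−n),u(k−1),…,u(k−n))`.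
The sequences `y` and `u` are indexed by `ℤ`, with their values at negative times
constrained to the chosen fixed vectors `yneg`, `uneg`. -/
theorem stmt_3 (n l h : ℕ) (hn : 1 ≤ n)
    (F : Matrix (Fin n) (Fin n) ℝ) (G : Matrix (Fin n) (Fin l) ℝ)
    (H : Matrix (Fin h) (Fin n) ℝ) (x₀ : Fin n → ℝ)
    (hctrl : (Matrix.of fun (i : Fin n) (p : Fin n × Fin l) =>
      (F ^ (p.1 : ℕ) * G) i p.2).rank = n)
    (hobs : (Matrix.of fun (p : Fin n × Fin h) (j : Fin n) =>
      (H * F ^ (p.1 : ℕ)) p.2 j).rank = n) :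
    ∃ (M : Matrix (Fin n) ((Fin n × Fin l) ⊕ (Fin n × Fin h)) ℝ)
      (yneg : Fin n → Fin l → ℝ) (uneg : Fin n → Fin h → ℝ),
      ∀ (y : ℤ → Fin l → ℝ) (u : ℤ → Fin h → ℝ) (x : ℕ → Fin n → ℝ),
        (∀ i : Fin n, y (-((i : ℤ) + 1)) = yneg i) →
        (∀ i : Fin n, u (-((i : ℤ) + 1)) = uneg i) →
        x 0 = x₀ →
        (∀ k : ℕ, x (k + 1) = F.mulVec (x k) + G.mulVec (y (k : ℤ))) →
        (∀ k : ℕ, u (k : ℤ) = H.mulVec (x k)) →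
        ∀ k : ℕ, x k = M.mulVec (Sum.elim
          (fun p : Fin n × Fin l => y ((k : ℤ) - ((p.1 : ℤ) + 1)) p.2)
          (fun p : Fin n × Fin h => u ((k : ℤ) - ((p.1 : ℤ) + 1)) p.2)) := by
  obtain ⟨v, hv⟩ := exists_windowState_eq F G x₀ hctrl
  obtain ⟨L, hL⟩ := LinearMap.exists_leftInverse_of_injective _ (windowData_injective F G H hobs)
  refine ⟨LinearMap.toMatrix' (windowState F G n ∘ₗ L), fun i b => v (i, b),
    fun i => H.mulVec (windowState F G (i.rev : ℕ) (0, v)), ?_⟩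
  intro y u x hy hu hx0 hx hux k
  let X : ℕ → Fin n → ℝ := fun j => if j ≤ n then windowState F G j (0, v) else x (j - n)
  have hXlate (j : ℕ) : X (j + n) = x j := by
    rcases Nat.eq_zero_or_pos j with rfl | hj
    · simp [X, hv, hx0]
    · simp [X, hj.ne']
  have hstep (j : ℕ) : X (j + 1) = F.mulVec (X j) + G.mulVec (y ((j : ℤ) - n)) := by
    rcases lt_or_ge j n with hj | hj
    · have hyj := hy (Fin.rev ⟨j, hj⟩)
      rw [show (-(((Fin.rev ⟨j, hj⟩ : Fin n) : ℕ) + 1 : ℤ)) = (j : ℤ) - n by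
        simp only [Fin.val_rev]; omega] at hyj
      simp only [X, if_pos hj.le, if_pos (show j + 1 ≤ n from hj), hyj]
      exact windowState_succ F G _ hj
    · obtain ⟨i, rfl⟩ := Nat.exists_eq_add_of_le' hj
      rw [show i + n + 1 = (i + 1) + n by ring, hXlate, hXlate, hx]
      simp
  have hout (j : ℕ) : u ((j : ℤ) - n) = H.mulVec (X j) := by
    rcases lt_or_ge j n with hj | hj
    · have huj := hu (Fin.rev ⟨j, hj⟩)
      rw [show (-(((Fin.rev ⟨j, hj⟩ : Fin n) : ℕ) + 1 : ℤ)) = (j : ℤ) - n by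
        simp only [Fin.val_rev]; omega] at huj
      simp only [X, if_pos hj.le, huj, Fin.rev_rev]
    · obtain ⟨i, rfl⟩ := Nat.exists_eq_add_of_le' hj
      rw [hXlate, ← hux]
      simp
  let e : (Fin n → ℝ) × (Fin n × Fin l → ℝ) :=
    (X k, fun p => y ((k : ℤ) - ((p.1 : ℤ) + 1)) p.2)
  have hwin (j : ℕ) (hj : j ≤ n) : windowState F G j e = X (k + j) := by
    induction j with
    | zero => rfl
    | succ j ih =>
      rw [windowState_succ F G e hj, ih (by omega), ← add_assoc, hstep]
      congr 2
      change y ((k : ℤ) - (((Fin.rev ⟨j, hj⟩ : Fin n) : ℕ) + 1 : ℤ)) = _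
      congr 1
      simp only [Fin.val_rev]
      omega
  have hdata : Sum.elim (fun p : Fin n × Fin l => y ((k : ℤ) - ((p.1 : ℤ) + 1)) p.2)
      (fun p : Fin n × Fin h => u ((k : ℤ) - ((p.1 : ℤ) + 1)) p.2) = windowData F G H e := by
    ext (p | p)
    · rfl
    · simp only [windowData, LinearMap.coe_mk, AddHom.coe_mk, Sum.elim_inr]
      rw [hwin _ p.1.rev.2.le, ← hout]
      refine congrFun (congrArg u ?_) p.2
      rw [Fin.val_rev]
      omega
  rw [hdata, LinearMap.toMatrix'_mulVec, LinearMap.comp_apply, ← LinearMap.comp_apply L, hL,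
    LinearMap.id_apply, hwin n le_rfl, hXlate]
end

section
/- Let n, l, h ∈ ℕ with n ≥ 1, F ∈ ℝ^{n×n}, G ∈ ℝ^{n×l}, H ∈ ℝ^{h×n}, R ∈ ℝ^{n×h}, and set F̄ := F − RH. Suppose F̄^n = 0. Define M := [G, F̄G, …, F̄^{n−1}G, R, F̄R, …, F̄^{n−1}R] ∈ ℝ^{n×n(l+h)} and 𝓗 := HM ∈ ℝ^{h×n(l+h)}. Then M𝓖 = G and M( 𝓕 + 𝓡𝓗 ) = FM, where 𝓕, 𝓖, 𝓡 are the block shift and insertion matrices defined in the context. -/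
/-- Index type for stacked vectors `col(v₁,…,vₙ,w₁,…,wₙ)` with `vᵢ ∈ ℝ^l`, `wᵢ ∈ ℝ^h`. -/
abbrev Idx (n l h : ℕ) := (Fin n × Fin l) ⊕ (Fin n × Fin h)

/-- The block shift matrix `𝓕` mapping `col(v₁,…,vₙ,w₁,…,wₙ)` to
`col(0, v₁, …, v_{n−1}, 0, w₁, …, w_{n−1})`. -/
def blockF (n l h : ℕ) : Matrix (Idx n l h) (Idx n l h) ℝ :=
  Matrix.of fun r c =>
    match r, c with
    | Sum.inl (i, a), Sum.inl (j, b) => if (i : ℕ) = (j : ℕ) + 1 ∧ a = b then 1 else 0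
    | Sum.inr (i, a), Sum.inr (j, b) => if (i : ℕ) = (j : ℕ) + 1 ∧ a = b then 1 else 0
    | _, _ => 0

/-- The insertion matrix `𝓖` mapping `y ∈ ℝ^l` to the vector with `y` in the first
`l`-block and zeros elsewhere. -/
def blockG (n l h : ℕ) : Matrix (Idx n l h) (Fin l) ℝ :=
  Matrix.of fun r b =>
    match r with
    | Sum.inl (i, a) => if (i : ℕ) = 0 ∧ a = b then 1 else 0
    | Sum.inr _ => 0

/-- The insertion matrix `𝓡` mapping `u ∈ ℝ^h` to the vector with `u` in the first
`h`-block and zeros elsewhere. -/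
def blockR (n l h : ℕ) : Matrix (Idx n l h) (Fin h) ℝ :=
  Matrix.of fun r b =>
    match r with
    | Sum.inl _ => 0
    | Sum.inr (i, a) => if (i : ℕ) = 0 ∧ a = b then 1 else 0

/-- Summing against the indicator of block position `m` and coordinate `b` picks out that entry,
or gives zero when `m` is past the last block. -/
theorem sum_mul_indicator_block {n k : ℕ} (f : Fin n × Fin k → ℝ) (m : ℕ) (b : Fin k) :
    ∑ x : Fin n × Fin k, f x * (if (x.1 : ℕ) = m ∧ x.2 = b then 1 else 0) =
      if hm : m < n then f (⟨m, hm⟩, b) else 0 := by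
  split_ifs with hm
  · rw [Finset.sum_eq_single (⟨m, hm⟩, b)]
    · simp
    · rintro ⟨i, a⟩ - hne
      have : ¬((i : ℕ) = m ∧ a = b) := fun hi => hne (Prod.ext (Fin.ext hi.1) hi.2)
      simp [this]
    · simp
  · refine Finset.sum_eq_zero fun x _ => ?_
    have : ¬((x.1 : ℕ) = m ∧ x.2 = b) := fun hx => hm (hx.1 ▸ x.1.isLt)
    simp [this]

/-- The block shift sends each power to the next one, and `A ^ n = 0` accounts for the last. -/
theorem sum_pow_mul_indicator_succ {n k : ℕ} {A : Matrix (Fin n) (Fin n) ℝ} (hA : A ^ n = 0)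
    (B : Matrix (Fin n) (Fin k) ℝ) (r j : Fin n) (b : Fin k) :
    ∑ x : Fin n × Fin k, (A ^ (x.1 : ℕ) * B) r x.2 *
      (if (x.1 : ℕ) = (j : ℕ) + 1 ∧ x.2 = b then 1 else 0) = (A * (A ^ (j : ℕ) * B)) r b := by
  rw [sum_mul_indicator_block (fun x => (A ^ (x.1 : ℕ) * B) r x.2), ← Matrix.mul_assoc,
    ← pow_succ']
  split_ifs with hj
  · rfl
  · rw [pow_eq_zero_of_le (not_lt.mp hj) hA]
    simp

/-- The block matrix `[G, AG, …, A^{n−1}G, R, AR, …, A^{n−1}R]`. -/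
def krylovBlocks {n l h : ℕ} (A : Matrix (Fin n) (Fin n) ℝ) (G : Matrix (Fin n) (Fin l) ℝ)
    (R : Matrix (Fin n) (Fin h) ℝ) : Matrix (Fin n) (Idx n l h) ℝ :=
  Matrix.fromCols (Matrix.of fun r x => (A ^ (x.1 : ℕ) * G) r x.2)
    (Matrix.of fun r x => (A ^ (x.1 : ℕ) * R) r x.2)

section

variable {n l h : ℕ} (A : Matrix (Fin n) (Fin n) ℝ) (G : Matrix (Fin n) (Fin l) ℝ)
  (R : Matrix (Fin n) (Fin h) ℝ)

theorem krylovBlocks_mul_blockG (hn : 1 ≤ n) : krylovBlocks A G R * blockG n l h = G := by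
  ext r b
  have key := sum_mul_indicator_block (n := n) (fun x => (A ^ (x.1 : ℕ) * G) r x.2) 0 b
  rw [dif_pos (Nat.lt_of_lt_of_le Nat.zero_lt_one hn), pow_zero, Matrix.one_mul] at key
  rw [Matrix.mul_apply, Fintype.sum_sum_type]
  refine Eq.trans ?_ key
  simp [krylovBlocks, blockG]

theorem krylovBlocks_mul_blockR (hn : 1 ≤ n) : krylovBlocks A G R * blockR n l h = R := by
  ext r b
  have key := sum_mul_indicator_block (n := n) (fun x => (A ^ (x.1 : ℕ) * R) r x.2) 0 b
  rw [dif_pos (Nat.lt_of_lt_of_le Nat.zero_lt_one hn), pow_zero, Matrix.one_mul] at key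
  rw [Matrix.mul_apply, Fintype.sum_sum_type]
  refine Eq.trans ?_ key
  simp [krylovBlocks, blockR]

theorem krylovBlocks_mul_blockF {A : Matrix (Fin n) (Fin n) ℝ} (hA : A ^ n = 0) :
    krylovBlocks A G R * blockF n l h = A * krylovBlocks A G R := by
  ext r c
  rw [Matrix.mul_apply, Fintype.sum_sum_type]
  rcases c with ⟨j, b⟩ | ⟨j, b⟩
  · refine Eq.trans ?_ (sum_pow_mul_indicator_succ hA G r j b)
    simp [krylovBlocks, blockF]
  · refine Eq.trans ?_ (sum_pow_mul_indicator_succ hA R r j b)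
    simp [krylovBlocks, blockF]

end

/-- with `F̄ := F − RH` nilpotent (`F̄^n = 0`) and
`M := [G, F̄G, …, F̄^{n−1}G, R, F̄R, …, F̄^{n−1}R]`, `𝓗 := HM`, we have
`M𝓖 = G` and `M(𝓕 + 𝓡𝓗) = FM`. -/
theorem stmt_4 (n l h : ℕ) (hn : 1 ≤ n)
    (F : Matrix (Fin n) (Fin n) ℝ) (G : Matrix (Fin n) (Fin l) ℝ)
    (H : Matrix (Fin h) (Fin n) ℝ) (R : Matrix (Fin n) (Fin h) ℝ)
    (hnil : (F - R * H) ^ n = 0)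
    (M : Matrix (Fin n) (Idx n l h) ℝ)
    (hM : M = Matrix.of fun r c =>
      match c with
      | Sum.inl (i, a) => ((F - R * H) ^ (i : ℕ) * G) r a
      | Sum.inr (i, a) => ((F - R * H) ^ (i : ℕ) * R) r a) :
    M * blockG n l h = G ∧
    M * (blockF n l h + blockR n l h * (H * M)) = F * M := by
  replace hM : M = krylovBlocks (F - R * H) G R := by
    rw [hM]
    ext r (_ | _) <;> rfl
  refine ⟨hM ▸ krylovBlocks_mul_blockG _ G R hn, ?_⟩
  have hF : M * blockF n l h = (F - R * H) * M := hM ▸ krylovBlocks_mul_blockF G R hnil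
  have hR : M * blockR n l h = R := hM ▸ krylovBlocks_mul_blockR _ G R hn
  rw [Matrix.mul_add, hF, ← Matrix.mul_assoc, hR, ← Matrix.mul_assoc, ← Matrix.add_mul,
    sub_add_cancel]
end

section
/- Consider a plant x_p(k+1) = A x_p(k) + B u(k), y(k) = C x_p(k), with A ∈ ℝ^{n_p×n_p}, B ∈ ℝ^{n_p×h}, C ∈ ℝ^{l×n_p}, and a controller with matrices F ∈ ℝ^{n×n}, G ∈ ℝ^{n×l}, H ∈ ℝ^{h×n} and initial state x₀ ∈ ℝ^n. Set n̄ := n(h+l), and let M ∈ ℝ^{n×n̄} and z₀ ∈ ℝ^{n̄} be given. Define the closed-loop matrices 𝖠 := [[A, BH],[GC, F]], 𝖡 := [[B, 0],[0, I_n]], 𝖢 := [[C, 0],[0, H]], and 𝗑₀ := col(x_p(0), x₀), and suppose there exist α ≥ 0 and γ ∈ [0,1) with ‖𝖠^k‖ ≤ α γ^k for all k ∈ ℕ. Set β := 1 + α‖𝖢‖‖𝖡‖/(1−γ), ε₀ := n̄β/2, ε₁ := ‖M‖(α‖𝖢‖ + β)/2, ε₂ := n̄β/4, ε₃ := n̄β(α‖𝖢‖‖𝗑₀‖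 + ‖z₀‖)/2. Let L > 0 and s > 0 be real numbers with 1/s > ε₀. Let (x_p, x, u, y) be trajectories of the perturbed closed loop: x_p(k+1) = A x_p(k) + B u(k), y(k) = C x_p(k), x(k+1) = F x(k) + G y(k) + e_x(k), u(k) = H x(k) + e_u(k), x(0) = x₀ + e₀, where the perturbations satisfy ‖e₀‖ ≤ (L/2)‖M‖, ‖e_x(k)‖ ≤ (L/2)‖M‖, and ‖e_u(k)‖ ≤ (s·n̄/2)( ‖col( y(k−1), …, y(k−n), u(k−1), …, u(k−n) )‖ + L/2 ) for all k ∈ ℕ, with the values of y and u at negative time indices given by the blocks of z₀ = col(y(−1),…,y(−n),u(−1),…,u(−n)). Let (x_p', x', u', y') be the trajectories of the unperturbed closed loop (the same equations with e₀ = 0, e_x ≡ 0, e_u ≡ 0) from the same plant initial state x_p(0). Then for all k ∈ ℕ, ‖col( u(k) − u'(k), y(k) − y'(k) )‖ ≤ ( ε₁ L + ε₂ L s + ε₃ s ) / ( 1 − ε₀ s ). -/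
attribute [local instance] Matrix.linftyOpNormedAddCommGroup

/-- The stacked vector `col(y(k−1),…,y(k−n),u(k−1),…,u(k−n))`, where the values of `y`
and `u` at negative time indices are given by the blocks of `z₀`. -/
def stack (n l h : ℕ) (y : ℕ → Fin l → ℝ) (u : ℕ → Fin h → ℝ)
    (z₀ : Idx n l h → ℝ) (k : ℕ) : Idx n l h → ℝ :=
  Sum.elim
    (fun p : Fin n × Fin l =>
      if (p.1 : ℕ) < k then y (k - (p.1 : ℕ) - 1) p.2
      else z₀ (Sum.inl (⟨(p.1 : ℕ) - k, lt_of_le_of_lt (Nat.sub_le _ _) p.1.isLt⟩, p.2)))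
    (fun p : Fin n × Fin h =>
      if (p.1 : ℕ) < k then u (k - (p.1 : ℕ) - 1) p.2
      else z₀ (Sum.inr (⟨(p.1 : ℕ) - k, lt_of_le_of_lt (Nat.sub_le _ _) p.1.isLt⟩, p.2)))

/-- The supremum norm of a concatenation is at most `r` if both pieces are. -/
lemma norm_sumElim_le {ι κ : Type*} [Fintype ι] [Fintype κ] {v : ι → ℝ} {w : κ → ℝ} {r : ℝ}
    (hv : ‖v‖ ≤ r) (hw : ‖w‖ ≤ r) : ‖Sum.elim v w‖ ≤ r := by
  rw [pi_norm_le_iff_of_nonneg ((norm_nonneg v).trans hv)]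
  rintro (i | i)
  · exact (norm_le_pi_norm v i).trans hv
  · exact (norm_le_pi_norm w i).trans hw

lemma norm_le_norm_sumElim_left {ι κ : Type*} [Fintype ι] [Fintype κ] (v : ι → ℝ) (w : κ → ℝ) :
    ‖v‖ ≤ ‖Sum.elim v w‖ :=
  (pi_norm_le_iff_of_nonneg (norm_nonneg _)).2 fun i => norm_le_pi_norm (Sum.elim v w) (Sum.inl i)

lemma norm_le_norm_sumElim_right {ι κ : Type*} [Fintype ι] [Fintype κ] (v : ι → ℝ) (w : κ → ℝ) :
    ‖w‖ ≤ ‖Sum.elim v w‖ :=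
  (pi_norm_le_iff_of_nonneg (norm_nonneg _)).2 fun i => norm_le_pi_norm (Sum.elim v w) (Sum.inr i)

/-- Exponential stability bounds the state of `d (k + 1) = A d k + B w k`, also after
propagation by a further power of `A`. -/
lemma norm_pow_mulVec_state_le {ι κ : Type*} [Fintype ι] [DecidableEq ι] [Fintype κ]
    {A : Matrix ι ι ℝ} {B : Matrix ι κ ℝ} {α γ : ℝ} (hα : 0 ≤ α) (hγ0 : 0 ≤ γ) (hγ1 : γ < 1)
    (hA : ∀ k : ℕ, ‖A ^ k‖ ≤ α * γ ^ k) {d : ℕ → ι → ℝ} {w : ℕ → κ → ℝ}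
    (hd : ∀ k, d (k + 1) = A.mulVec (d k) + B.mulVec (w k)) {W : ℝ} (hW : 0 ≤ W) (k : ℕ)
    (hw : ∀ j < k, ‖w j‖ ≤ W) (m : ℕ) :
    ‖(A ^ m).mulVec (d k)‖ ≤ α * γ ^ m * (‖d 0‖ + ‖B‖ * W / (1 - γ)) := by
  have hγ : 0 < 1 - γ := sub_pos.2 hγ1
  induction k generalizing m with
  | zero =>
    refine (Matrix.linfty_opNorm_mulVec _ _).trans ?_
    refine mul_le_mul (hA m) ?_ (norm_nonneg _) (by positivity)
    exact le_add_of_nonneg_right (by positivity)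
  | succ k ih =>
    have h1 := ih (fun j hj => hw j (hj.trans k.lt_succ_self)) (m + 1)
    have h2 : ‖(A ^ m).mulVec (B.mulVec (w k))‖ ≤ α * γ ^ m * (‖B‖ * W) := by
      refine (Matrix.linfty_opNorm_mulVec _ _).trans ?_
      refine mul_le_mul (hA m) ?_ (norm_nonneg _) (by positivity)
      refine (Matrix.linfty_opNorm_mulVec _ _).trans ?_
      exact mul_le_mul_of_nonneg_left (hw k k.lt_succ_self) (norm_nonneg _)
    have h3 : (A ^ m).mulVec (d (k + 1))
        = (A ^ (m + 1)).mulVec (d k) + (A ^ m).mulVec (B.mulVec (w k)) := by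
      rw [hd, Matrix.mulVec_add, Matrix.mulVec_mulVec, ← pow_succ]
    rw [h3]
    refine (norm_add_le _ _).trans ((add_le_add h1 h2).trans ?_)
    have h4 : γ * (‖d 0‖ + ‖B‖ * W / (1 - γ)) + ‖B‖ * W ≤ ‖d 0‖ + ‖B‖ * W / (1 - γ) := by
      have h5 : ‖B‖ * W / (1 - γ) - γ * (‖B‖ * W / (1 - γ)) = ‖B‖ * W := by
        field_simp
      nlinarith [mul_nonneg hγ.le (norm_nonneg (d 0))]
    calc α * γ ^ (m + 1) * (‖d 0‖ + ‖B‖ * W / (1 - γ)) + α * γ ^ m * (‖B‖ * W)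
        = α * γ ^ m * (γ * (‖d 0‖ + ‖B‖ * W / (1 - γ)) + ‖B‖ * W) := by ring
      _ ≤ _ := mul_le_mul_of_nonneg_left h4 (by positivity)

lemma norm_state_le {ι κ : Type*} [Fintype ι] [DecidableEq ι] [Fintype κ]
    {A : Matrix ι ι ℝ} {B : Matrix ι κ ℝ} {α γ : ℝ} (hα : 0 ≤ α) (hγ0 : 0 ≤ γ) (hγ1 : γ < 1)
    (hA : ∀ k : ℕ, ‖A ^ k‖ ≤ α * γ ^ k) {d : ℕ → ι → ℝ} {w : ℕ → κ → ℝ}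
    (hd : ∀ k, d (k + 1) = A.mulVec (d k) + B.mulVec (w k)) {W : ℝ} (hW : 0 ≤ W) (k : ℕ)
    (hw : ∀ j < k, ‖w j‖ ≤ W) :
    ‖d k‖ ≤ α * (‖d 0‖ + ‖B‖ * W / (1 - γ)) := by
  simpa using norm_pow_mulVec_state_le hα hγ0 hγ1 hA hd hW k hw 0

/-- The free response satisfies `‖A ^ k x‖ ≤ α ‖x‖`. -/
lemma norm_free_state_le {ι : Type*} [Fintype ι] [DecidableEq ι]
    {A : Matrix ι ι ℝ} {α γ : ℝ} (hα : 0 ≤ α) (hγ0 : 0 ≤ γ) (hγ1 : γ < 1)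
    (hA : ∀ k : ℕ, ‖A ^ k‖ ≤ α * γ ^ k) {d : ℕ → ι → ℝ}
    (hd : ∀ k, d (k + 1) = A.mulVec (d k)) (k : ℕ) :
    ‖d k‖ ≤ α * ‖d 0‖ := by
  simpa using norm_state_le (B := (0 : Matrix ι (Fin 0) ℝ)) (w := 0) hα hγ0 hγ1 hA
    (by simpa using hd) le_rfl k (by simp)

/-- A bound on the past inputs, outputs and on `z₀` bounds the stacked vector. -/
lemma norm_stack_le {n l h : ℕ} {y : ℕ → Fin l → ℝ} {u : ℕ → Fin h → ℝ} {z₀ : Idx n l h → ℝ}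
    {k : ℕ} {r : ℝ} (hz : ‖z₀‖ ≤ r) (hy : ∀ j < k, ‖y j‖ ≤ r) (hu : ∀ j < k, ‖u j‖ ≤ r) :
    ‖stack n l h y u z₀ k‖ ≤ r := by
  rw [pi_norm_le_iff_of_nonneg ((norm_nonneg z₀).trans hz)]
  rintro (p | p)
  · simp only [stack, Sum.elim_inl]
    split_ifs with hp
    · exact (norm_le_pi_norm _ _).trans (hy _ (by omega))
    · exact (norm_le_pi_norm z₀ _).trans hz
  · simp only [stack, Sum.elim_inr]
    split_ifs with hp
    · exact (norm_le_pi_norm _ _).trans (hu _ (by omega))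
    · exact (norm_le_pi_norm z₀ _).trans hz

/-- performance bound of the perturbed closed loop versus the nominal
closed loop.  Here `𝖠 = [[A, BH],[GC, F]]`, `𝖡 = [[B, 0],[0, Iₙ]]`, `𝖢 = [[C, 0],[0, H]]`,
`𝗑₀ = col(x_p(0), x₀)`, `β := 1 + α‖𝖢‖‖𝖡‖/(1−γ)`, `ε₀ := n̄β/2`,
`ε₁ := ‖M‖(α‖𝖢‖ + β)/2`, `ε₂ := n̄β/4`, `ε₃ := n̄β(α‖𝖢‖‖𝗑₀‖ + ‖z₀‖)/2` with `n̄ = n(h+l)`.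
If `1/s > ε₀` and the perturbations obey the stated bounds, then for all `k`,
`‖col(u(k) − u'(k), y(k) − y'(k))‖ ≤ (ε₁L + ε₂Ls + ε₃s)/(1 − ε₀s)`. -/
theorem stmt_11 (np n h l : ℕ) (hn : 1 ≤ n)
    (A : Matrix (Fin np) (Fin np) ℝ) (B : Matrix (Fin np) (Fin h) ℝ)
    (C : Matrix (Fin l) (Fin np) ℝ)
    (F : Matrix (Fin n) (Fin n) ℝ) (G : Matrix (Fin n) (Fin l) ℝ)
    (H : Matrix (Fin h) (Fin n) ℝ)
    (x₀ : Fin n → ℝ)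
    (M : Matrix (Fin n) (Idx n l h) ℝ) (z₀ : Idx n l h → ℝ)
    (α γ : ℝ) (hα : 0 ≤ α) (hγ0 : 0 ≤ γ) (hγ1 : γ < 1)
    (hA : ∀ k : ℕ, ‖(Matrix.fromBlocks A (B * H) (G * C) F) ^ k‖ ≤ α * γ ^ k)
    (L s : ℝ) (hL : 0 < L) (hs : 0 < s)
    -- the perturbed closed-loop trajectories
    (xp : ℕ → Fin np → ℝ) (x : ℕ → Fin n → ℝ)
    (u : ℕ → Fin h → ℝ) (y : ℕ → Fin l → ℝ)
    (e₀ : Fin n → ℝ) (ex : ℕ → Fin n → ℝ) (eu : ℕ → Fin h → ℝ)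
    (hxp : ∀ k : ℕ, xp (k + 1) = A.mulVec (xp k) + B.mulVec (u k))
    (hy : ∀ k : ℕ, y k = C.mulVec (xp k))
    (hx : ∀ k : ℕ, x (k + 1) = F.mulVec (x k) + G.mulVec (y k) + ex k)
    (hu : ∀ k : ℕ, u k = H.mulVec (x k) + eu k)
    (hx0 : x 0 = x₀ + e₀)
    (he₀ : ‖e₀‖ ≤ L / 2 * ‖M‖)
    (hex : ∀ k : ℕ, ‖ex k‖ ≤ L / 2 * ‖M‖)
    (heu : ∀ k : ℕ, ‖eu k‖ ≤ s * (n * (h + l) : ℕ) / 2 *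
      (‖stack n l h y u z₀ k‖ + L / 2))
    -- the nominal (unperturbed) closed-loop trajectories from the same plant
    -- initial state
    (xp' : ℕ → Fin np → ℝ) (x' : ℕ → Fin n → ℝ)
    (u' : ℕ → Fin h → ℝ) (y' : ℕ → Fin l → ℝ)
    (hxp'0 : xp' 0 = xp 0)
    (hxp' : ∀ k : ℕ, xp' (k + 1) = A.mulVec (xp' k) + B.mulVec (u' k))
    (hy' : ∀ k : ℕ, y' k = C.mulVec (xp' k))
    (hx' : ∀ k : ℕ, x' (k + 1) = F.mulVec (x' k) + G.mulVec (y' k))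
    (hu' : ∀ k : ℕ, u' k = H.mulVec (x' k))
    (hx'0 : x' 0 = x₀)
    -- the constants
    (β ε₀ ε₁ ε₂ ε₃ : ℝ)
    (hβ : β = 1 + α * ‖Matrix.fromBlocks C 0 0 H‖ *
      ‖Matrix.fromBlocks B 0 0 (1 : Matrix (Fin n) (Fin n) ℝ)‖ / (1 - γ))
    (hε₀ : ε₀ = (n * (h + l) : ℕ) * β / 2)
    (hε₁ : ε₁ = ‖M‖ * (α * ‖Matrix.fromBlocks C 0 0 H‖ + β) / 2)
    (hε₂ : ε₂ = (n * (h + l) : ℕ) * β / 4)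
    (hε₃ : ε₃ = (n * (h + l) : ℕ) * β *
      (α * ‖Matrix.fromBlocks C 0 0 H‖ * ‖Sum.elim (xp 0) x₀‖ + ‖z₀‖) / 2)
    (hsε : ε₀ < 1 / s) :
    ∀ k : ℕ, ‖Sum.elim (u k - u' k) (y k - y' k)‖
      ≤ (ε₁ * L + ε₂ * L * s + ε₃ * s) / (1 - ε₀ * s) := by
  set Ccl := Matrix.fromBlocks C 0 0 H with hCcl
  set Bcl := Matrix.fromBlocks B 0 0 (1 : Matrix (Fin n) (Fin n) ℝ) with hBcl
  set Acl := Matrix.fromBlocks A (B * H) (G * C) F with hAcl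
  have hγ : 0 < 1 - γ := sub_pos.2 hγ1
  have hβ1 : 1 ≤ β := by
    rw [hβ]
    exact le_add_of_nonneg_right (by positivity)
  have hβ0 : 0 ≤ β := zero_le_one.trans hβ1
  have hden : 0 < 1 - ε₀ * s := by
    rw [lt_div_iff₀ hs] at hsε
    linarith
  set R := (ε₁ * L + ε₂ * L * s + ε₃ * s) / (1 - ε₀ * s) with hR
  have hRnn : 0 ≤ R := by
    have : 0 ≤ ε₁ := by rw [hε₁]; positivity
    have : 0 ≤ ε₂ := by rw [hε₂]; positivity
    have : 0 ≤ ε₃ := by rw [hε₃]; positivity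
    positivity
  have hRfix : ε₁ * L + ε₂ * L * s + ε₃ * s + ε₀ * s * R = R := by
    have : R * (1 - ε₀ * s) = ε₁ * L + ε₂ * L * s + ε₃ * s := div_mul_cancel₀ _ hden.ne'
    linarith
  -- the nominal closed loop
  have hnom : ∀ k, ‖Sum.elim (y' k) (u' k)‖ ≤ α * ‖Ccl‖ * ‖Sum.elim (xp 0) x₀‖ := by
    intro k
    have h1 := norm_free_state_le (d := fun k => Sum.elim (xp' k) (x' k)) hα hγ0 hγ1 hA
      (fun k => by
        simp only [hAcl, Matrix.fromBlocks_mulVec, Sum.elim_comp_inl, Sum.elim_comp_inr,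
          hxp', hx', hu', hy', Matrix.mulVec_mulVec, add_comm]) k
    have h2 : Sum.elim (y' k) (u' k) = Ccl.mulVec (Sum.elim (xp' k) (x' k)) := by
      simp [hCcl, Matrix.fromBlocks_mulVec, hu', hy']
    rw [h2]
    refine (Matrix.linfty_opNorm_mulVec _ _).trans ?_
    simp only [hxp'0, hx'0] at h1
    calc _ ≤ ‖Ccl‖ * (α * ‖Sum.elim (xp 0) x₀‖) := mul_le_mul_of_nonneg_left h1 (norm_nonneg _)
      _ = _ := by ring
  -- the deviation from the nominal closed loop
  have hdev : ∀ k, Sum.elim (xp (k + 1) - xp' (k + 1)) (x (k + 1) - x' (k + 1))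
      = Acl.mulVec (Sum.elim (xp k - xp' k) (x k - x' k)) + Bcl.mulVec (Sum.elim (eu k) (ex k)) := by
    intro k
    simp only [hAcl, hBcl, Matrix.fromBlocks_mulVec, Sum.elim_comp_inl, Sum.elim_comp_inr,
      Matrix.zero_mulVec, Matrix.one_mulVec, ← Matrix.mulVec_mulVec, Matrix.mulVec_sub,
      hxp, hx, hu, hxp', hx', hu', hy, hy', Matrix.mulVec_add, ← Sum.elim_add_add]
    congr 1 <;> abel
  intro k
  induction k using Nat.strong_induction_on with
  | _ k ih =>
    set S := α * ‖Ccl‖ * ‖Sum.elim (xp 0) x₀‖ + ‖z₀‖ + R with hS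
    set E := s * (n * (h + l) : ℕ) / 2 * (S + L / 2) with hE
    have hnn : 0 ≤ α * ‖Ccl‖ * ‖Sum.elim (xp 0) x₀‖ := by positivity
    have hy_le : ∀ j < k, ‖y j‖ ≤ S := fun j hj => by
      have h1 := (norm_le_norm_sumElim_right _ _).trans (ih j hj)
      have h2 := (norm_le_norm_sumElim_left _ _).trans (hnom j)
      have h3 := norm_le_norm_sub_add (y j) (y' j)
      linarith [norm_nonneg z₀]
    have hu_le : ∀ j < k, ‖u j‖ ≤ S := fun j hj => by
      have h1 := (norm_le_norm_sumElim_left _ _).trans (ih j hj)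
      have h2 := (norm_le_norm_sumElim_right _ _).trans (hnom j)
      have h3 := norm_le_norm_sub_add (u j) (u' j)
      linarith [norm_nonneg z₀]
    have heu_le : ∀ j ≤ k, ‖eu j‖ ≤ E := fun j hj => by
      refine (heu j).trans (mul_le_mul_of_nonneg_left ?_ (by positivity))
      refine add_le_add (norm_stack_le (by linarith) ?_ ?_) le_rfl
      · exact fun i hi => hy_le i (hi.trans_le hj)
      · exact fun i hi => hu_le i (hi.trans_le hj)
    have hE0 : 0 ≤ E := (norm_nonneg _).trans (heu_le k le_rfl)
    have hM0 : 0 ≤ L / 2 * ‖M‖ := by positivity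
    have hstate := norm_state_le (d := fun k => Sum.elim (xp k - xp' k) (x k - x' k))
      (w := fun k => Sum.elim (eu k) (ex k)) hα hγ0 hγ1 hA hdev (add_nonneg hM0 hE0) k
      (fun j hj => norm_sumElim_le (by linarith [heu_le j hj.le]) (by linarith [hex j]))
    have hinit : ‖Sum.elim (xp 0 - xp' 0) (x 0 - x' 0)‖ ≤ L / 2 * ‖M‖ := by
      refine norm_sumElim_le ?_ ?_
      · simpa [hxp'0] using hM0
      · simpa [hx0, hx'0] using he₀
    set D := Sum.elim (xp k - xp' k) (x k - x' k) with hD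
    have hCD : ‖Ccl.mulVec D‖
        ≤ ‖Ccl‖ * (α * (L / 2 * ‖M‖ + ‖Bcl‖ * (L / 2 * ‖M‖ + E) / (1 - γ))) := by
      refine (Matrix.linfty_opNorm_mulVec _ _).trans ?_
      refine mul_le_mul_of_nonneg_left (hstate.trans ?_) (norm_nonneg _)
      exact mul_le_mul_of_nonneg_left (add_le_add hinit le_rfl) hα
    have hCD' : Ccl.mulVec D = Sum.elim (C.mulVec (xp k - xp' k)) (H.mulVec (x k - x' k)) := by
      simp [hCcl, hD, Matrix.fromBlocks_mulVec]
    rw [hCD'] at hCD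
    have hyk : y k - y' k = C.mulVec (xp k - xp' k) := by
      rw [hy, hy', Matrix.mulVec_sub]
    have huk : u k - u' k = H.mulVec (x k - x' k) + eu k := by
      rw [hu, hu', Matrix.mulVec_sub]
      abel
    have hfinal : ‖Ccl‖ * (α * (L / 2 * ‖M‖ + ‖Bcl‖ * (L / 2 * ‖M‖ + E) / (1 - γ)))
        + (L / 2 * ‖M‖ + E) = R := by
      rw [← hRfix, hε₁, hε₂, hε₃, hε₀]
      have h1 : ‖Ccl‖ * (α * (L / 2 * ‖M‖ + ‖Bcl‖ * (L / 2 * ‖M‖ + E) / (1 - γ)))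
          + (L / 2 * ‖M‖ + E) = ‖Ccl‖ * α * (L / 2 * ‖M‖) + β * (L / 2 * ‖M‖ + E) := by
        rw [hβ]
        ring
      rw [h1, hE, hS]
      ring
    refine norm_sumElim_le ?_ ?_
    · rw [huk]
      have h1 := (norm_le_norm_sumElim_right _ _).trans hCD
      linarith [norm_add_le (H.mulVec (x k - x' k)) (eu k), heu_le k le_rfl]
    · rw [hyk]
      have h1 := (norm_le_norm_sumElim_left _ _).trans hCD
      linarith
end

section
/- Let p ∈ ℕ with p ≥ 1, let N be a prime with N ≡ 1 (mod 2p), and let ζ ∈ ZMod N be an element of multiplicative order exactly 2p. Then the map from (ZMod N)[X] to the product ring (ZMod N)^p sending a polynomial f to the tuple of evaluations ( f(ζ), f(ζ³), …, f(ζ^{2p−1}) ) descends to a well-defined ring isomorphism from the quotient ring (ZMod N)[X] / (X^p + 1) onto (ZMod N)^p. -/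
open Polynomial

/-- A monic polynomial of degree `n` which vanishes at `n` distinct points
generates the kernel of the evaluation at these points. -/
theorem ker_pi_evalRingHom {F : Type*} [Field F] {n : ℕ} {a : Fin n → F}
    (ha : Function.Injective a) {P : F[X]} (hP : P.Monic) (hdeg : P.natDegree = n)
    (hroot : ∀ i, P.eval (a i) = 0) :
    RingHom.ker (RingHom.pi fun i => evalRingHom (a i)) = Ideal.span {P} := by
  ext f
  rw [RingHom.mem_ker, Ideal.mem_span_singleton, funext_iff]
  change (∀ i, f.eval (a i) = 0) ↔ P ∣ f
  constructor
  · intro hf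
    rw [← modByMonic_eq_zero_iff_dvd hP]
    refine eq_zero_of_degree_lt_of_eval_index_eq_zero (Finset.univ (α := Fin n)) ha.injOn ?_ ?_
    · simpa [degree_eq_natDegree hP.ne_zero, hdeg] using degree_modByMonic_lt f hP
    · intro i _
      rw [modByMonic_eq_sub_mul_div, eval_sub, eval_mul, hroot, hf, zero_mul, sub_zero]
  · rintro ⟨g, rfl⟩ i
    simp [hroot]

/-- Evaluation at finitely many distinct points of a field is surjective. -/
theorem pi_evalRingHom_surjective {F ι : Type*} [Field F] [Fintype ι] {a : ι → F}
    (ha : Function.Injective a) :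
    Function.Surjective (RingHom.pi fun i => evalRingHom (a i)) := by
  classical
  intro v
  exact ⟨Lagrange.interpolate Finset.univ a v, funext fun i =>
    Lagrange.eval_interpolate_at_node v ha.injOn (Finset.mem_univ i)⟩

/-- with `N` prime, `N ≡ 1 (mod 2p)`, and `ζ ∈ ZMod N` of multiplicative
order exactly `2p`, the evaluation map `f ↦ (f(ζ), f(ζ³), …, f(ζ^{2p−1}))` descends to a
ring isomorphism `(ZMod N)[X]/(X^p + 1) ≃+* (ZMod N)^p`. -/
theorem stmt_16 (p N : ℕ) (hp : 1 ≤ p) (hN : N.Prime) (hmod : N % (2 * p) = 1)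
    (ζ : ZMod N) (hζ : orderOf ζ = 2 * p) :
    ∃ φ : (Polynomial (ZMod N) ⧸
        Ideal.span {(X ^ p + 1 : Polynomial (ZMod N))}) ≃+* (Fin p → ZMod N),
      ∀ f : Polynomial (ZMod N),
        φ (Ideal.Quotient.mk (Ideal.span {(X ^ p + 1 : Polynomial (ZMod N))}) f) =
          fun i : Fin p => f.eval (ζ ^ (2 * (i : ℕ) + 1)) := by
  have := Fact.mk hN
  have hinj : Function.Injective fun i : Fin p => ζ ^ (2 * (i : ℕ) + 1) := by
    intro i j hij
    have := pow_injOn_Iio_orderOf (x := ζ) (by simp only [hζ, Set.mem_Iio]; omega)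
      (by simp only [hζ, Set.mem_Iio]; omega) hij
    exact Fin.ext (by omega)
  have hζp : ζ ^ p = -1 := by
    have hsq : (ζ ^ p) ^ 2 = 1 := by
      rw [← pow_mul, mul_comm, ← hζ, pow_orderOf_eq_one]
    exact (sq_eq_sq_iff_eq_or_eq_neg.1 (hsq.trans (one_pow 2).symm)).resolve_left (pow_ne_one_of_lt_orderOf (by omega) (by omega))
  have hker := ker_pi_evalRingHom hinj (monic_X_pow_add_C (1 : ZMod N) (by omega))
    natDegree_X_pow_add_C (fun i => by
      rw [eval_add, eval_pow, eval_X, eval_C, pow_right_comm, hζp,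
        (odd_two_mul_add_one (i : ℕ)).neg_one_pow, neg_add_cancel])
  rw [C_1] at hker
  exact ⟨(Ideal.quotEquivOfEq hker.symm).trans
    (RingHom.quotientKerEquivOfSurjective (pi_evalRingHom_surjective hinj)), fun f => rfl⟩
end

section
/- Let p ≥ 1, N ≥ 2, q ≥ 2 be integers, and let φ: ℤ[X] → (ZMod q)[X]/(X^p + 1) denote the canonical ring homomorphism (coefficient-wise reduction modulo q followed by the quotient map). Let s, a, e, m ∈ ℤ[X], and define the ciphertext c := ( φ(a·s + N·e + m), φ(−a) ) ∈ ( (ZMod q)[X]/(X^p+1) )². Then: (i) c₁ + c₂ · φ(s) = φ(N·e + m); and (ii) if r ∈ ℤ[X] denotes the remainder of N·e + m upon division by X^p + 1 in ℤ[X] and every coefficient of r lies in the interval [−q/2, q/2), then r is the unique polynomial in ℤ[X] of degree < p with all coefficients in [−q/2, q/2) satisfying φ(r) = c₁ + c₂·φ(s), and moreover the image of r under the canonical ring homomorphism ℤ[X] → (ZMod N)[X]/(X^p+1) equals the image of m under the same homomorphism. -/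
open Polynomial

/-- The canonical ring homomorphism `ℤ[X] → (ZMod q)[X]/(X^p + 1)`: coefficient-wise
reduction modulo `q` followed by the quotient map. -/
noncomputable def canonMap (p q : ℕ) :
    Polynomial ℤ →+*
      (Polynomial (ZMod q) ⧸ Ideal.span {((X : Polynomial (ZMod q)) ^ p + 1)}) :=
  (Ideal.Quotient.mk (Ideal.span {((X : Polynomial (ZMod q)) ^ p + 1)})).comp
    (Polynomial.mapRingHom (Int.castRingHom (ZMod q)))

theorem monic_X_pow_add_one {R : Type*} [CommRing R] {p : ℕ} (hp : 1 ≤ p) :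
    ((X : Polynomial R) ^ p + 1).Monic := by
  simpa using monic_X_pow_add_C (1 : R) (by omega : p ≠ 0)

theorem degree_X_pow_add_one {R : Type*} [CommRing R] [Nontrivial R] {p : ℕ} (hp : 1 ≤ p) :
    ((X : Polynomial R) ^ p + 1).degree = p := by
  simpa using degree_X_pow_add_C (by omega : 0 < p) (1 : R)

theorem canonMap_eq_iff_dvd (p q : ℕ) (f g : Polynomial ℤ) :
    canonMap p q f = canonMap p q g ↔
      ((X : Polynomial (ZMod q)) ^ p + 1) ∣ (f - g).map (Int.castRingHom (ZMod q)) := by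
  rw [← Ideal.mem_span_singleton, Polynomial.map_sub, ← Ideal.Quotient.eq]
  rfl

theorem canonMap_X_pow_add_one (p q : ℕ) :
    canonMap p q ((X : Polynomial ℤ) ^ p + 1) = 0 := by
  rw [← map_zero (canonMap p q), canonMap_eq_iff_dvd]
  simp

theorem canonMap_modByMonic (p q : ℕ) (f : Polynomial ℤ) :
    canonMap p q (f %ₘ ((X : Polynomial ℤ) ^ p + 1)) = canonMap p q f := by
  conv_rhs => rw [← modByMonic_add_div f ((X : Polynomial ℤ) ^ p + 1)]
  rw [map_add, map_mul, canonMap_X_pow_add_one, zero_mul, add_zero]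

theorem canonMap_natCast_self (p N : ℕ) : canonMap p N (N : Polynomial ℤ) = 0 := by
  rw [← map_zero (canonMap p N), canonMap_eq_iff_dvd]
  simp

/-- Polynomials of degree less than `p` with centered coefficients are determined by their image
under `canonMap p q`. -/
theorem eq_of_canonMap_eq {p q : ℕ} (hp : 1 ≤ p) (hq : 2 ≤ q) {f g : Polynomial ℤ}
    (hf : f.degree < (p : WithBot ℕ)) (hg : g.degree < (p : WithBot ℕ))
    (hfc : ∀ i : ℕ, -(q : ℤ) ≤ 2 * f.coeff i ∧ 2 * f.coeff i < (q : ℤ))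
    (hgc : ∀ i : ℕ, -(q : ℤ) ≤ 2 * g.coeff i ∧ 2 * g.coeff i < (q : ℤ))
    (h : canonMap p q f = canonMap p q g) : f = g := by
  have : Fact (1 < q) := ⟨hq⟩
  rw [canonMap_eq_iff_dvd] at h
  have hdeg : ((f - g).map (Int.castRingHom (ZMod q))).degree <
      ((X : Polynomial (ZMod q)) ^ p + 1).degree := by
    rw [degree_X_pow_add_one hp]
    exact degree_map_le.trans_lt ((degree_sub_le f g).trans_lt (max_lt hf hg))
  have hzero : (f - g).map (Int.castRingHom (ZMod q)) = 0 := by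
    by_contra hne
    exact (monic_X_pow_add_one hp).not_dvd_of_degree_lt hne hdeg h
  ext i
  have hi := congrArg (fun P => P.coeff i) hzero
  simp only [coeff_map, coeff_sub, eq_intCast, coeff_zero] at hi
  have hdvd := (ZMod.intCast_zmod_eq_zero_iff_dvd _ q).mp hi
  have habs : |f.coeff i - g.coeff i| < (q : ℤ) := by
    have := hfc i
    have := hgc i
    rw [abs_lt]
    constructor <;> omega
  exact sub_eq_zero.mp (Int.eq_zero_of_abs_lt_dvd hdvd habs)

/-- BGV decryption correctness. With `c := (φ(a·s + N·e + m), φ(−a))`: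
(i) `c₁ + c₂·φ(s) = φ(N·e + m)`; (ii) if `r := (N·e + m) mod (X^p + 1)` over `ℤ[X]` has
all coefficients in `[−q/2, q/2)`, then `r` is the unique polynomial of degree `< p`
with coefficients in `[−q/2, q/2)` satisfying `φ(r) = c₁ + c₂·φ(s)`, and the image of
`r` in `(ZMod N)[X]/(X^p+1)` equals that of `m`. -/
theorem stmt_18 (p N q : ℕ) (hp : 1 ≤ p) (hN : 2 ≤ N) (hq : 2 ≤ q)
    (s a e m : Polynomial ℤ) :
    (canonMap p q (a * s + (N : Polynomial ℤ) * e + m) + canonMap p q (-a) * canonMap p q s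
        = canonMap p q ((N : Polynomial ℤ) * e + m)) ∧
    (∀ r : Polynomial ℤ,
      r = ((N : Polynomial ℤ) * e + m) %ₘ ((X : Polynomial ℤ) ^ p + 1) →
      (∀ i : ℕ, -(q : ℤ) ≤ 2 * r.coeff i ∧ 2 * r.coeff i < (q : ℤ)) →
      r.degree < (p : WithBot ℕ) ∧
      canonMap p q r = canonMap p q (a * s + (N : Polynomial ℤ) * e + m)
        + canonMap p q (-a) * canonMap p q s ∧
      (∀ r' : Polynomial ℤ, r'.degree < (p : WithBot ℕ) →
        (∀ i : ℕ, -(q : ℤ) ≤ 2 * r'.coeff i ∧ 2 * r'.coeff i < (q : ℤ)) →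
        canonMap p q r' = canonMap p q (a * s + (N : Polynomial ℤ) * e + m)
          + canonMap p q (-a) * canonMap p q s →
        r' = r) ∧
      canonMap p N r = canonMap p N m) := by
  have hdec : canonMap p q (a * s + (N : Polynomial ℤ) * e + m)
      + canonMap p q (-a) * canonMap p q s = canonMap p q ((N : Polynomial ℤ) * e + m) := by
    rw [← map_mul, ← map_add]
    congr 1
    ring
  refine ⟨hdec, ?_⟩
  rintro r hr hcoeff
  have hdeg : r.degree < (p : WithBot ℕ) := by
    rw [hr, ← degree_X_pow_add_one (R := ℤ) hp]
    exact degree_modByMonic_lt _ (monic_X_pow_add_one hp)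
  have himage (k : ℕ) : canonMap p k r = canonMap p k ((N : Polynomial ℤ) * e + m) := by
    rw [hr, canonMap_modByMonic]
  rw [hdec]
  refine ⟨hdeg, himage q, fun r' hdeg' hcoeff' h => ?_, ?_⟩
  · exact eq_of_canonMap_eq hp hq hdeg' hdeg hcoeff' hcoeff (h.trans (himage q).symm)
  · rw [himage N, map_add, map_mul, canonMap_natCast_self, zero_mul, zero_add]
end
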